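/- arXiv:0805.1909 — 4 statements merged into one kernel-verified Lean document; each statement's English description precedes it below -/
import Mathlib

section
/- Let A_n be the free associative unital ℂ-algebra on generators x_1,…,x_n. If a_1,…,a_i ∈ A_n and for some 1 ≤ k ≤ i the element a_k lies in M_3(A_n), then the iterated commutator […[[a_1,a_2],a_3],…,a_i] lies in M_{i+1}(A_n). -/
noncomputable section

/-- `lcs k A n` is the `(n+1)`-st term `L_{n+1}(A)` of the lower central series of `A`
regarded as a Lie algebra under the commutator `[a,b] = a*b - b*a`:
`lcs k A 0 = L_1(A) = A` and `L_{n+2}(A) = span [A, L_{n+1}(A)]`. -/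
def lcs (k A : Type*) [Field k] [Ring A] [Algebra k A] : ℕ → Submodule k A
  | 0 => ⊤
  | n + 1 => Submodule.span k {x | ∃ a : A, ∃ b ∈ lcs k A n, x = a * b - b * a}

/-- `Lser k A i = L_i(A)` for `i ≥ 1`. -/
def Lser (k A : Type*) [Field k] [Ring A] [Algebra k A] (i : ℕ) : Submodule k A :=
  lcs k A (i - 1)

/-- The two-sided ideal of `A` generated by a set `S`, as a `k`-submodule. -/
def idealGen (k : Type*) {A : Type*} [Field k] [Ring A] [Algebra k A] (S : Set A) :
    Submodule k A :=
  Submodule.span k {x | ∃ a b : A, ∃ s ∈ S, x = a * s * b}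

/-- `Mser k A i = M_i(A)`, the two-sided ideal of `A` generated by `L_i(A)`. -/
def Mser (k A : Type*) [Field k] [Ring A] [Algebra k A] (i : ℕ) : Submodule k A :=
  idealGen k (Lser k A i : Set A)

/-- The left-iterated commutator `[...[[a_1,a_2],a_3],...,a_r]` of a list `[a_1, ..., a_r]`. -/
def listComm {A : Type*} [Ring A] : List A → A
  | [] => 1
  | a :: t => t.foldl (fun x y => x * y - y * x) a

section LowerCentralSeries

variable {k A : Type*} [Field k] [Ring A] [Algebra k A]

theorem comm_mem_lcs_succ {m : ℕ} (a : A) {b : A} (hb : b ∈ lcs k A m) :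
    a * b - b * a ∈ lcs k A (m + 1) :=
  Submodule.subset_span ⟨a, b, hb, rfl⟩

theorem comm_mem_lcs_succ' {m : ℕ} {a : A} (b : A) (ha : a ∈ lcs k A m) :
    a * b - b * a ∈ lcs k A (m + 1) := by
  rw [← neg_sub]
  exact neg_mem (comm_mem_lcs_succ b ha)

theorem lcs_succ_le (m : ℕ) : lcs k A (m + 1) ≤ lcs k A m := by
  induction m with
  | zero => exact le_top
  | succ m ih =>
    refine Submodule.span_le.mpr ?_
    rintro _ ⟨a, b, hb, rfl⟩
    exact comm_mem_lcs_succ a (ih hb)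

theorem lcs_antitone : Antitone (lcs k A) :=
  antitone_nat_of_succ_le lcs_succ_le

/-- If `[x, A] ⊆ L_{m+1}` then `[x, L_{j+1}] ⊆ L_{m+j+1}`. -/
theorem comm_mem_lcs_add {j m : ℕ} {x y : A}
    (hx : ∀ e, x * e - e * x ∈ lcs k A m) (hy : y ∈ lcs k A j) :
    x * y - y * x ∈ lcs k A (m + j) := by
  induction j generalizing m x y with
  | zero => exact hx y
  | succ j ih =>
    have hle : lcs k A (j + 1) ≤ (lcs k A (m + (j + 1))).comap
        (LinearMap.mulLeft k x - LinearMap.mulRight k x) := by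
      refine Submodule.span_le.mpr ?_
      rintro _ ⟨a, b, hb, rfl⟩
      have h₁ := ih (m := m + 1) (fun e => comm_mem_lcs_succ' e (hx a)) hb
      have h₂ := comm_mem_lcs_succ a (ih hx hb)
      rw [show m + 1 + j = m + (j + 1) by ring] at h₁
      have h := add_mem h₁ h₂
      simp only [Submodule.comap_coe, Set.mem_preimage, SetLike.mem_coe, LinearMap.sub_apply,
        LinearMap.mulLeft_apply, LinearMap.mulRight_apply]
      convert h using 1
      noncomm_ring
    exact hle hy

theorem foldl_comm_mem_lcs {m : ℕ} {x : A} (l : List A) (hx : x ∈ lcs k A m) :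
    l.foldl (fun x y => x * y - y * x) x ∈ lcs k A (m + l.length) := by
  induction l generalizing m x with
  | nil => exact hx
  | cons y l ih =>
    have h := ih (comm_mem_lcs_succ' y hx)
    rwa [show m + 1 + l.length = m + (y :: l).length by simp only [List.length_cons]; ring] at h

/-- A function alternating in its first three and in its last two arguments, and satisfying the
Jacobi identity in its last three arguments, vanishes. -/
theorem eq_zero_of_alternating_of_jacobi {X M : Type*} [AddCommGroup M] [IsAddTorsionFree M]
    (G : X → X → X → X → X → M)
    (h₁₂ : ∀ a b c d e, G a b c d e = -G b a c d e)
    (h₁₃ : ∀ a b c d e, G a b c d e = -G c b a d e)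
    (h₄₅ : ∀ a b c d e, G a b c d e = -G a b c e d)
    (hJ : ∀ a b c d e, G a b c d e + G a b d e c + G a b e c d = 0) (a b c d e : X) :
    G a b c d e = 0 := by
  have h₂₃ : ∀ a b c d e, G a b c d e = -G a c b d e := fun a b c d e => by
    rw [h₁₂, h₁₃, h₁₂, neg_neg]
  have jab := hJ a b c d e
  rw [h₄₅ a b d e c] at jab
  have jac := hJ a c b d e
  rw [h₂₃ a c b d e, h₄₅ a c d e b] at jac
  have jad := hJ a d b c e
  rw [h₂₃ a d b c e, h₂₃ a d c e b, h₄₅ a c d e b] at jad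
  have jae := hJ a e b c d
  rw [h₂₃ a e b c d, h₂₃ a e c d b, h₄₅ a c e d b, h₂₃ a e d b c] at jae
  have jbc := hJ b c a d e
  rw [h₁₂ b c a d e, h₁₃ c b a d e, h₄₅ b c d e a] at jbc
  have jbd := hJ b d a c e
  rw [h₁₂ b d a c e, h₁₃ d b a c e, h₂₃ b d c e a, h₄₅ b c d e a] at jbd
  have jbe := hJ b e a c d
  rw [h₁₂ b e a c d, h₁₃ e b a c d, h₂₃ b e c d a, h₄₅ b c e d a, h₂₃ b e d a c] at jbe
  have jcd := hJ c d a b e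
  rw [h₁₂ c d a b e, h₁₃ d c a b e, h₁₂ c d b e a, h₁₃ d c b e a, h₄₅ b c d e a] at jcd
  have jce := hJ c e a b d
  rw [h₁₂ c e a b d, h₁₃ e c a b d, h₁₂ c e b d a, h₁₃ e c b d a, h₄₅ b c e d a,
    h₂₃ c e d a b] at jce
  have jde := hJ d e a b c
  rw [h₁₂ d e a b c, h₁₃ e d a b c, h₁₂ d e b c a, h₁₃ e d b c a, h₄₅ b d e c a, h₁₂ d e c a b,
    h₁₃ e d c a b] at jde
  refine (smul_eq_zero_iff_right (by norm_num : (6 : ℤ) ≠ 0)).mp ?_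
  linear_combination (norm := module) (2 : ℤ) • jab + (-2 : ℤ) • jac + (-1 : ℤ) • jad +
    (1 : ℤ) • jae + (2 : ℤ) • jbc + (1 : ℤ) • jbd + (-1 : ℤ) • jbe +
    (-1 : ℤ) • jcd + (1 : ℤ) • jce + (2 : ℤ) • jde

/-- `[a s, e] ∈ L_4` for `s ∈ L_3`. -/
theorem comm_mul_mem_lcs_three [CharZero k] (a e : A) {s : A} (hs : s ∈ lcs k A 2) :
    a * s * e - e * (a * s) ∈ lcs k A 3 := by
  let br : A → A → A := fun x y => x * y - y * x
  have h3 (b c d : A) : br b (br c d) ∈ lcs k A 2 :=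
    comm_mem_lcs_succ b (comm_mem_lcs_succ c (Submodule.mem_top : d ∈ lcs k A 0))
  have h4 (x b c d : A) : br x (br b (br c d)) ∈ lcs k A 3 := comm_mem_lcs_succ x (h3 b c d)
  let π := (lcs k A 3).mkQ
  have hπ {x : A} (hx : x ∈ lcs k A 3) : π x = 0 := (Submodule.Quotient.mk_eq_zero _).mpr hx
  have : IsAddTorsionFree (A ⧸ lcs k A 3) := .of_isTorsionFree k _
  have key (a e b c d : A) : π (br (a * br b (br c d)) e) = 0 := by
    refine eq_zero_of_alternating_of_jacobi
      (fun a e b c d => π (br (a * br b (br c d)) e)) ?_ ?_ ?_ ?_ a e b c d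
    · intro a e b c d
      rw [eq_neg_iff_add_eq_zero, ← map_add]
      refine hπ ?_
      have h := sub_mem (neg_mem (h4 (e * a) b c d))
        (comm_mem_lcs_succ a (lcs_succ_le _ (h4 e b c d)))
      convert h using 1
      simp only [br]
      noncomm_ring
    · intro a e b c d
      rw [eq_neg_iff_add_eq_zero, ← map_add]
      refine hπ ?_
      have h := add_mem (comm_mem_lcs_succ' e (h3 (a * b + b * a) c d))
        (add_mem (comm_mem_lcs_succ' e (lcs_succ_le _ (h4 b a c d)))
          (comm_mem_lcs_succ' e (lcs_succ_le _ (h4 a b c d))))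
      refine ((lcs k A 3).smul_mem_iff (two_ne_zero : (2 : k) ≠ 0)).mp ?_
      rw [two_smul]
      convert h using 1
      simp only [br]
      noncomm_ring
    · intro a e b c d
      rw [← map_neg]
      congr 1
      simp only [br]
      noncomm_ring
    · intro a e b c d
      rw [← map_add, ← map_add]
      refine (congrArg π ?_).trans (map_zero π)
      simp only [br]
      noncomm_ring
  have hle : lcs k A 2 ≤ (lcs k A 3).comap
      ((LinearMap.mulRight k e - LinearMap.mulLeft k e) ∘ₗ LinearMap.mulLeft k a) := by
    refine Submodule.span_le.mpr ?_
    rintro _ ⟨b, w, hw, rfl⟩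
    have hle' : lcs k A 1 ≤ (lcs k A 3).comap
        ((LinearMap.mulRight k e - LinearMap.mulLeft k e) ∘ₗ LinearMap.mulLeft k a ∘ₗ
          (LinearMap.mulLeft k b - LinearMap.mulRight k b)) := by
      refine Submodule.span_le.mpr ?_
      rintro _ ⟨c, d, -, rfl⟩
      exact (Submodule.Quotient.mk_eq_zero (lcs k A 3)).mp (key a e b c d)
    exact hle' hw
  exact hle hs

theorem comm_mem_lcs_three_of_mem_Mser [CharZero k] {x : A} (hx : x ∈ Mser k A 3) (e : A) :
    x * e - e * x ∈ lcs k A 3 := by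
  have hle : Mser k A 3 ≤ (lcs k A 3).comap
      (LinearMap.mulRight k e - LinearMap.mulLeft k e) := by
    refine Submodule.span_le.mpr ?_
    rintro _ ⟨a, b, s, hs, rfl⟩
    have h := add_mem (comm_mul_mem_lcs_three (a * b) e hs)
      (comm_mul_mem_lcs_three a e (lcs_succ_le _ (comm_mem_lcs_succ' b hs)))
    simp only [Submodule.comap_coe, Set.mem_preimage, SetLike.mem_coe, LinearMap.sub_apply,
      LinearMap.mulLeft_apply, LinearMap.mulRight_apply]
    convert h using 1
    noncomm_ring
  exact hle hx

theorem lcs_le_Mser_succ (m : ℕ) : lcs k A m ≤ Mser k A (m + 1) := fun x hx =>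
  Submodule.subset_span ⟨1, 1, x, hx, by simp⟩

theorem Mser_antitone : Antitone (Mser k A) := fun i j hij => by
  refine Submodule.span_mono ?_
  rintro _ ⟨a, b, s, hs, rfl⟩
  exact ⟨a, b, s, lcs_antitone (Nat.sub_le_sub_right hij 1) hs, rfl⟩

theorem listComm_mem_Mser_succ [CharZero k] {l : List A} {y : A} (hl : y ∈ l)
    (hy : y ∈ Mser k A 3) : listComm l ∈ Mser k A (l.length + 1) := by
  obtain ⟨l₁, l₂, rfl⟩ := List.append_of_mem hl
  have hy' := comm_mem_lcs_three_of_mem_Mser hy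
  match l₁, l₂ with
  | [], [] => exact Mser_antitone (by simp) hy
  | [], z :: l =>
    refine lcs_le_Mser_succ _ (lcs_antitone ?_ (foldl_comm_mem_lcs l (hy' z)))
    simp only [List.nil_append, List.length_cons]
    omega
  | x :: t, l =>
    have hx : t.foldl (fun x y => x * y - y * x) x ∈ lcs k A (0 + t.length) :=
      foldl_comm_mem_lcs t Submodule.mem_top
    have h := neg_mem (comm_mem_lcs_add hy' hx)
    rw [neg_sub] at h
    have h' := foldl_comm_mem_lcs l h
    simp only [listComm, List.cons_append, List.foldl_append, List.foldl_cons]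
    refine lcs_le_Mser_succ _ (lcs_antitone ?_ h')
    simp only [List.length_cons, List.length_append]
    omega

end LowerCentralSeries

/-- In the free associative unital `ℂ`-algebra on `n` generators: if `a_1, ..., a_i` are
elements and `a_k ∈ M_3` for some `1 ≤ k ≤ i`, then the iterated commutator
`[...[[a_1,a_2],a_3],...,a_i]` lies in `M_{i+1}`. -/
theorem iterated_comm_mem_Mser_succ (n i : ℕ) (a : Fin i → FreeAlgebra ℂ (Fin n))
    (k : Fin i) (hk : a k ∈ Mser ℂ (FreeAlgebra ℂ (Fin n)) 3) :
    listComm (List.ofFn a) ∈ Mser ℂ (FreeAlgebra ℂ (Fin n)) (i + 1) := by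
  have h := listComm_mem_Mser_succ (List.mem_ofFn.mpr ⟨k, rfl⟩ : a k ∈ List.ofFn a) hk
  rwa [List.length_ofFn] at h
end
end

section
/- (Jennings) Let A be a finitely generated associative unital algebra over a field which is Lie nilpotent, i.e., M_{i+1}(A) = 0 for some i ≥ 1. Then M_2(A) is a nilpotent ideal: there exists N ≥ 1 such that any product of N elements of M_2(A) is zero. -/
noncomputable section

section Jennings

variable {k A : Type*} [Field k] [Ring A] [Algebra k A]

theorem subset_idealGen (S : Set A) : S ⊆ idealGen k S := fun s hs =>
  Submodule.subset_span ⟨1, 1, s, hs, by simp⟩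

theorem mul_mem_idealGen_left {S : Set A} (a : A) {x : A} (hx : x ∈ idealGen k S) :
    a * x ∈ idealGen k S := by
  induction hx using Submodule.span_induction with
  | mem x hx =>
    obtain ⟨p, q, s, hs, rfl⟩ := hx
    exact Submodule.subset_span ⟨a * p, q, s, hs, by simp only [mul_assoc]⟩
  | zero => simp
  | add x y _ _ hx hy => rw [mul_add]; exact add_mem hx hy
  | smul c x _ hx => rw [mul_smul_comm]; exact Submodule.smul_mem _ c hx

theorem mul_mem_idealGen_right {S : Set A} (a : A) {x : A} (hx : x ∈ idealGen k S) :
    x * a ∈ idealGen k S := by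
  induction hx using Submodule.span_induction with
  | mem x hx =>
    obtain ⟨p, q, s, hs, rfl⟩ := hx
    exact Submodule.subset_span ⟨p, q * a, s, hs, by simp only [mul_assoc]⟩
  | zero => simp
  | add x y _ _ hx hy => rw [add_mul]; exact add_mem hx hy
  | smul c x _ hx => rw [smul_mul_assoc]; exact Submodule.smul_mem _ c hx

theorem mul_idealGen_le (P : Submodule k A) (S : Set A) : P * idealGen k S ≤ idealGen k S :=
  Submodule.mul_le.2 fun a _ _ hx => mul_mem_idealGen_left a hx

theorem idealGen_mul_le (P : Submodule k A) (S : Set A) : idealGen k S * P ≤ idealGen k S :=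
  Submodule.mul_le.2 fun _ hx a _ => mul_mem_idealGen_right a hx

theorem sup_pow_le (S : Set A) (K : Submodule k A) (m : ℕ) :
    (idealGen k S ⊔ K) ^ m ≤ idealGen k S ⊔ K ^ m := by
  induction m with
  | zero => simp
  | succ m ih =>
    rw [pow_succ, pow_succ]
    refine (mul_le_mul_left ih _).trans ?_
    rw [Submodule.sup_mul, Submodule.mul_sup (K ^ m)]
    exact sup_le ((idealGen_mul_le _ S).trans le_sup_left)
      (sup_le_sup_right (mul_idealGen_le _ S) _)

theorem sup_pow_mul_two_le {S T : Set A} {K : Submodule k A} {m : ℕ}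
    (hS : idealGen k S * idealGen k S ≤ idealGen k T) (hK : K ^ m ≤ idealGen k T) :
    (idealGen k S ⊔ K) ^ (m * 2) ≤ idealGen k T := by
  have h : (idealGen k S ⊔ K) ^ m ≤ idealGen k S ⊔ idealGen k T :=
    (sup_pow_le S K m).trans (sup_le_sup_left hK _)
  rw [pow_mul, pow_two]
  refine (mul_le_mul' h h).trans ?_
  rw [Submodule.sup_mul, Submodule.mul_sup (idealGen k S)]
  exact sup_le (sup_le hS (mul_idealGen_le _ T)) (idealGen_mul_le _ T)

theorem exists_finset_sup_pow_le {ι : Type*} (s : Finset ι) (S : ι → Set A) (T : Set A)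
    (h : ∀ i ∈ s, idealGen k (S i) * idealGen k (S i) ≤ idealGen k T) :
    ∃ m : ℕ, (s.sup fun i => idealGen k (S i)) ^ m ≤ idealGen k T := by
  classical
  induction s using Finset.induction_on with
  | empty => exact ⟨1, by simp⟩
  | insert i s _ ih =>
    obtain ⟨m, hm⟩ := ih fun j hj => h j (Finset.mem_insert_of_mem hj)
    refine ⟨m * 2, ?_⟩
    rw [Finset.sup_insert]
    exact sup_pow_mul_two_le (h i (Finset.mem_insert_self i s)) hm

theorem mul_finset_sup_le {ι : Type*} (s : Finset ι) (S : ι → Set A) (P : Submodule k A) :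
    P * (s.sup fun i => idealGen k (S i)) ≤ s.sup fun i => idealGen k (S i) := by
  rw [Finset.sup_eq_iSup]
  simp only [Submodule.mul_iSup]
  exact iSup₂_mono fun i _ => mul_idealGen_le _ _

theorem finset_sup_mul_le {ι : Type*} (s : Finset ι) (S : ι → Set A) (P : Submodule k A) :
    (s.sup fun i => idealGen k (S i)) * P ≤ s.sup fun i => idealGen k (S i) := by
  rw [Finset.sup_eq_iSup]
  simp only [Submodule.iSup_mul]
  exact iSup₂_mono fun i _ => idealGen_mul_le _ _

theorem commutator_mem_lcs_succ {n : ℕ} (a : A) {b : A} (hb : b ∈ lcs k A n) :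
    a * b - b * a ∈ lcs k A (n + 1) :=
  Submodule.subset_span ⟨a, b, hb, rfl⟩

/-- Modulo `M_{n+3}`, commutators `[a, b]` with `b ∈ L_{n+1}` annihilate all `[a, c]`. -/
theorem commutator_mul_commutator_mem {n : ℕ} (a c : A) {b : A} (hb : b ∈ lcs k A n) :
    (a * b - b * a) * (a * c - c * a) ∈ idealGen k (lcs k A (n + 2) : Set A) := by
  have key (x y : A) : x * (y * b - b * y) - (y * b - b * y) * x ∈
      idealGen k (lcs k A (n + 2) : Set A) :=
    subset_idealGen _ (commutator_mem_lcs_succ x (commutator_mem_lcs_succ y hb))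
  have h := sub_mem (sub_mem (key a (a * c)) (mul_mem_idealGen_left a (key a c)))
    (mul_mem_idealGen_right c (key a a))
  convert h using 1
  noncomm_ring

theorem idealGen_commutator_mul_self_le (n : ℕ) (x : A) :
    idealGen k ((fun b => x * b - b * x) '' (lcs k A n : Set A)) *
      idealGen k ((fun b => x * b - b * x) '' (lcs k A n : Set A)) ≤
      idealGen k (lcs k A (n + 2) : Set A) := by
  rw [idealGen, Submodule.span_mul_span]
  refine Submodule.span_le.2 ?_
  rintro _ ⟨_, ⟨p, q, _, ⟨b, hb, rfl⟩, rfl⟩, _, ⟨r, t, _, ⟨c, hc, rfl⟩, rfl⟩, rfl⟩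
  have hcomm := subset_idealGen (k := k) _
    (commutator_mem_lcs_succ (q * r) (commutator_mem_lcs_succ x hb))
  have hprod := commutator_mul_commutator_mem x c hb
  have h := sub_mem (mul_mem_idealGen_right t (mul_mem_idealGen_left (p * (q * r)) hprod))
    (mul_mem_idealGen_right t (mul_mem_idealGen_right (x * c - c * x)
      (mul_mem_idealGen_left p hcomm)))
  convert h using 1
  simp only [SetLike.mem_coe]
  noncomm_ring

theorem commutator_mem_sup_of_mem_adjoin {n : ℕ} {s : Finset A} {a b : A}
    (ha : a ∈ Algebra.adjoin k (s : Set A)) (hb : b ∈ lcs k A n) :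
    a * b - b * a ∈
      s.sup fun x => idealGen k ((fun b => x * b - b * x) '' (lcs k A n : Set A)) := by
  induction ha using Algebra.adjoin_induction with
  | mem x hx =>
    exact Finset.le_sup (f := fun x =>
      idealGen k ((fun b => x * b - b * x) '' (lcs k A n : Set A))) hx
      (subset_idealGen _ ⟨b, hb, rfl⟩)
  | algebraMap c => simp [Algebra.commutes c b]
  | add x y _ _ hx hy =>
    convert add_mem hx hy using 1
    noncomm_ring
  | mul x y _ _ hx hy =>
    convert add_mem (mul_finset_sup_le s _ ⊤ (Submodule.mul_mem_mul (Submodule.mem_top (x := x)) hy))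
      (finset_sup_mul_le s _ ⊤ (Submodule.mul_mem_mul hx (Submodule.mem_top (x := y)))) using 1
    noncomm_ring

variable (k A) in
theorem exists_idealGen_lcs_pow_le [Algebra.FiniteType k A] (n : ℕ) :
    ∃ m : ℕ, idealGen k (lcs k A (n + 1) : Set A) ^ m ≤
      idealGen k (lcs k A (n + 2) : Set A) := by
  obtain ⟨s, hs⟩ := Algebra.FiniteType.out (R := k) (A := A)
  obtain ⟨m, hm⟩ := exists_finset_sup_pow_le (k := k) s
    (fun x => (fun b => x * b - b * x) '' (lcs k A n : Set A)) (lcs k A (n + 2) : Set A)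
    fun x _ => idealGen_commutator_mul_self_le n x
  refine ⟨m, (pow_le_pow_left' ?_ m).trans hm⟩
  refine Submodule.span_le.2 ?_
  rintro _ ⟨p, q, z, hz, rfl⟩
  refine finset_sup_mul_le s _ ⊤ (Submodule.mul_mem_mul (mul_finset_sup_le s _ ⊤
    (Submodule.mul_mem_mul Submodule.mem_top ?_)) Submodule.mem_top)
  refine Submodule.span_le.2 ?_ hz
  rintro _ ⟨a, b, hb, rfl⟩
  exact commutator_mem_sup_of_mem_adjoin (hs ▸ Algebra.mem_top) hb

variable (k A) in
theorem exists_Mser_two_pow_le [Algebra.FiniteType k A] (d : ℕ) :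
    ∃ N : ℕ, Mser k A 2 ^ N ≤ Mser k A (d + 2) := by
  induction d with
  | zero => exact ⟨1, by simp⟩
  | succ d ih =>
    obtain ⟨N, hN⟩ := ih
    obtain ⟨m, hm⟩ := exists_idealGen_lcs_pow_le k A d
    exact ⟨N * m, by rw [pow_mul]; exact (pow_le_pow_left' hN m).trans hm⟩

theorem prod_ofFn_mem_pow (M : Submodule k A) :
    ∀ {N : ℕ} (f : Fin N → A), (∀ j, f j ∈ M) → (List.ofFn f).prod ∈ M ^ N
  | 0, _, _ => ⟨1, by simp⟩
  | N + 1, f, hf => by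
    rw [List.ofFn_succ, List.prod_cons, pow_succ']
    exact Submodule.mul_mem_mul (hf 0) (prod_ofFn_mem_pow M _ fun j => hf j.succ)

end Jennings

/-- **Jennings.** If `A` is a finitely generated associative unital algebra over a field
which is Lie nilpotent (i.e. `M_{i+1}(A) = 0` for some `i ≥ 1`), then `M_2(A)` is a
nilpotent ideal: there is `N ≥ 1` such that any product of `N` elements of `M_2(A)`
is zero. -/
theorem jennings (k A : Type*) [Field k] [Ring A] [Algebra k A] [Algebra.FiniteType k A]
    (hnilp : ∃ i : ℕ, 1 ≤ i ∧ Mser k A (i + 1) = ⊥) :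
    ∃ N : ℕ, 1 ≤ N ∧ ∀ f : Fin N → A, (∀ j, f j ∈ Mser k A 2) → (List.ofFn f).prod = 0 := by
  obtain ⟨i, hi, hbot⟩ := hnilp
  obtain ⟨d, rfl⟩ := Nat.exists_eq_add_of_le' hi
  obtain ⟨N, hN⟩ := exists_Mser_two_pow_le k A d
  refine ⟨N + 1, by omega, fun f hf => ?_⟩
  have hpow : Mser k A 2 ^ N = ⊥ := le_bot_iff.1 (hN.trans hbot.le)
  have h := prod_ofFn_mem_pow _ f hf
  rwa [pow_succ, hpow, Submodule.bot_mul, Submodule.mem_bot] at h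
end
end

section
/- Let A_2 be the free associative unital ℂ-algebra on generators x_1, x_2. The element [x_1,x_2]^2 lies in M_3(A_2), but does not lie in the subspace M_4(A_2) + span(L_3(A_2)); in particular, [x_1,x_2]^2 ∉ M_4(A_2). -/
noncomputable section

/-- The commutator `[a, b] = a*b - b*a`. -/
def ringComm {A : Type*} [Ring A] (a b : A) : A := a * b - b * a

open Polynomial in
/-- The representation of the free algebra sending the generators to `X • E₀₁` and `X • E₁₀`. -/
def gradedRep : FreeAlgebra ℂ (Fin 2) →ₐ[ℂ] Matrix (Fin 2) (Fin 2) ℂ[X] :=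
  FreeAlgebra.lift ℂ ![!![0, X; 0, 0], !![0, 0; X, 0]]

open Polynomial in
/-- The coefficient of `X ^ 4` in the trace of `gradedRep`. -/
def gradedTrace : FreeAlgebra ℂ (Fin 2) →ₗ[ℂ] ℂ :=
  (lcoeff ℂ 4) ∘ₗ (Matrix.traceLinearMap (Fin 2) ℂ ℂ[X]) ∘ₗ gradedRep.toLinearMap

open Polynomial in
theorem gradedTrace_apply (a : FreeAlgebra ℂ (Fin 2)) :
    gradedTrace a = (gradedRep a).trace.coeff 4 := rfl

theorem gradedTrace_commutator (a b : FreeAlgebra ℂ (Fin 2)) :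
    gradedTrace (a * b - b * a) = 0 := by
  rw [gradedTrace_apply, map_sub, map_mul, map_mul, Matrix.trace_sub, Matrix.trace_mul_comm,
    sub_self, Polynomial.coeff_zero]

open Polynomial in
theorem exists_gradedRep_eq (a : FreeAlgebra ℂ (Fin 2)) :
    ∃ (c : ℂ) (M : Matrix (Fin 2) (Fin 2) ℂ[X]), gradedRep a = c • 1 + (X : ℂ[X]) • M := by
  induction a using FreeAlgebra.induction with
  | grade0 r => exact ⟨r, 0, by simp [Algebra.algebraMap_eq_smul_one]⟩
  | grade1 i =>
    fin_cases i
    · exact ⟨0, !![0, 1; 0, 0], by simp [gradedRep, Matrix.smul_of]⟩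
    · exact ⟨0, !![0, 0; 1, 0], by simp [gradedRep, Matrix.smul_of]⟩
  | mul a b ha hb =>
    obtain ⟨c, M, hM⟩ := ha
    obtain ⟨d, N, hN⟩ := hb
    refine ⟨c * d, c • N + d • M + (X : ℂ[X]) • (M * N), ?_⟩
    rw [map_mul, hM, hN]
    simp only [add_mul, mul_add, smul_mul_assoc, mul_smul_comm, one_mul, mul_one, smul_add,
      smul_smul, smul_comm (X : ℂ[X]) (_ : ℂ)]
    rw [mul_comm d c]
    abel
  | add a b ha hb =>
    obtain ⟨c, M, hM⟩ := ha
    obtain ⟨d, N, hN⟩ := hb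
    refine ⟨c + d, M + N, ?_⟩
    rw [map_add, hM, hN, add_smul, smul_add]
    abel

open Polynomial in
theorem exists_gradedRep_commutator_eq (a : FreeAlgebra ℂ (Fin 2))
    (N : Matrix (Fin 2) (Fin 2) ℂ[X]) :
    ∃ M, gradedRep a * N - N * gradedRep a = (X : ℂ[X]) • M := by
  obtain ⟨c, M, hM⟩ := exists_gradedRep_eq a
  refine ⟨M * N - N * M, ?_⟩
  rw [hM]
  simp only [add_mul, mul_add, smul_mul_assoc, mul_smul_comm, one_mul, mul_one, smul_sub]
  abel

open Polynomial in
theorem exists_gradedRep_eq_of_mem_lcs (n : ℕ) {l : FreeAlgebra ℂ (Fin 2)}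
    (hl : l ∈ lcs ℂ (FreeAlgebra ℂ (Fin 2)) (n + 1)) :
    ∃ M, gradedRep l = (X : ℂ[X]) ^ (n + 2) • M := by
  induction n generalizing l with
  | zero =>
    refine Submodule.span_induction ?_ ⟨0, by simp⟩ ?_ ?_ hl
    · rintro _ ⟨a, b, -, rfl⟩
      obtain ⟨d, N, hN⟩ := exists_gradedRep_eq b
      obtain ⟨M, hM⟩ := exists_gradedRep_commutator_eq a N
      refine ⟨M, ?_⟩
      rw [zero_add, pow_two, mul_smul, ← hM, map_sub, map_mul, map_mul, hN]
      simp only [add_mul, mul_add, smul_mul_assoc, mul_smul_comm, one_mul, mul_one, smul_sub]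
      abel
    · rintro _ _ - - ⟨M, hM⟩ ⟨N, hN⟩
      exact ⟨M + N, by rw [map_add, hM, hN, smul_add]⟩
    · rintro c _ - ⟨M, hM⟩
      exact ⟨c • M, by rw [map_smul, hM, smul_comm]⟩
  | succ n ih =>
    refine Submodule.span_induction ?_ ⟨0, by simp⟩ ?_ ?_ hl
    · rintro _ ⟨a, b, hb, rfl⟩
      obtain ⟨N, hN⟩ := ih hb
      obtain ⟨M, hM⟩ := exists_gradedRep_commutator_eq a N
      refine ⟨M, ?_⟩
      rw [add_right_comm n 1 2, pow_succ, mul_smul, ← hM, map_sub, map_mul, map_mul, hN,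
        mul_smul_comm, smul_mul_assoc, smul_sub]
    · rintro _ _ - - ⟨M, hM⟩ ⟨N, hN⟩
      exact ⟨M + N, by rw [map_add, hM, hN, smul_add]⟩
    · rintro c _ - ⟨M, hM⟩
      exact ⟨c • M, by rw [map_smul, hM, smul_comm]⟩

theorem gradedTrace_eq_zero_of_mem_lcs_succ (n : ℕ) {l : FreeAlgebra ℂ (Fin 2)}
    (hl : l ∈ lcs ℂ (FreeAlgebra ℂ (Fin 2)) (n + 1)) : gradedTrace l = 0 := by
  have h : lcs ℂ (FreeAlgebra ℂ (Fin 2)) (n + 1) ≤ LinearMap.ker gradedTrace := by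
    refine Submodule.span_le.2 ?_
    rintro _ ⟨a, b, -, rfl⟩
    exact gradedTrace_commutator a b
  exact h hl

open Polynomial in
theorem Mser_four_le_ker_gradedTrace :
    Mser ℂ (FreeAlgebra ℂ (Fin 2)) 4 ≤ LinearMap.ker gradedTrace := by
  refine Submodule.span_le.2 ?_
  rintro _ ⟨a, b, l, hl, rfl⟩
  obtain ⟨L, hL⟩ := exists_gradedRep_eq_of_mem_lcs 2 hl
  have h0 := gradedTrace_eq_zero_of_mem_lcs_succ 2 hl
  obtain ⟨c, M, hM⟩ := exists_gradedRep_eq a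
  obtain ⟨d, N, hN⟩ := exists_gradedRep_eq b
  have key : gradedRep (a * l * b) = (c * d) • gradedRep l +
      (X : ℂ[X]) ^ 5 • (c • (L * N) + d • (M * L) + (X : ℂ[X]) • (M * L * N)) := by
    rw [map_mul, map_mul, hM, hN, hL, pow_succ _ 4]
    simp only [add_mul, mul_add, smul_mul_assoc, mul_smul_comm, one_mul, mul_one, smul_add,
      smul_smul, smul_comm (_ : ℂ[X]) (_ : ℂ), mul_comm d c]
    ring_nf
    abel
  rw [SetLike.mem_coe, LinearMap.mem_ker, gradedTrace_apply, key, Matrix.trace_add,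
    Matrix.trace_smul, Matrix.trace_smul, coeff_add, coeff_smul, ← gradedTrace_apply, h0,
    smul_zero, zero_add, smul_eq_mul, coeff_X_pow_mul']
  simp

open Polynomial in
theorem gradedTrace_ringComm_sq :
    gradedTrace (ringComm (FreeAlgebra.ι ℂ (0 : Fin 2)) (FreeAlgebra.ι ℂ (1 : Fin 2)) ^ 2) = 2 := by
  have h : gradedRep (ringComm (FreeAlgebra.ι ℂ (0 : Fin 2)) (FreeAlgebra.ι ℂ (1 : Fin 2)) ^ 2) =
      !![X ^ 4, 0; 0, X ^ 4] := by
    simp only [ringComm, gradedRep, map_sub, map_mul, FreeAlgebra.lift_ι_apply, pow_two]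
    ext i j : 1
    fin_cases i <;> fin_cases j <;> simp [Matrix.mul_apply, Fin.sum_univ_two] <;> ring
  rw [gradedTrace_apply, h, Matrix.trace_fin_two_of, coeff_add, coeff_X_pow]
  norm_num

theorem mul_mul_mem_Mser {k A : Type*} [Field k] [Ring A] [Algebra k A] {i : ℕ} {s : A}
    (hs : s ∈ Lser k A i) (a b : A) : a * s * b ∈ Mser k A i :=
  Submodule.subset_span ⟨a, b, s, hs, rfl⟩

theorem ringComm_ringComm_mem_Lser_three {k A : Type*} [Field k] [Ring A] [Algebra k A]
    (a b c : A) : ringComm a (ringComm b c) ∈ Lser k A 3 :=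
  Submodule.subset_span ⟨a, _, Submodule.subset_span ⟨b, c, trivial, rfl⟩, rfl⟩

theorem ringComm_sq_mem_Mser_three {k A : Type*} [Field k] [Ring A] [Algebra k A]
    (h2 : (2 : k) ≠ 0) (x y : A) : ringComm x y ^ 2 ∈ Mser k A 3 := by
  have h : ringComm x y ^ 2 = (2 : k)⁻¹ • (1 * ringComm x (ringComm x (y ^ 2)) * 1
      - y * ringComm x (ringComm x y) * 1 - 1 * ringComm x (ringComm x y) * y) := by
    rw [eq_inv_smul_iff₀ h2, two_smul]
    simp only [ringComm]
    noncomm_ring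
  rw [h]
  exact Submodule.smul_mem _ _ (Submodule.sub_mem _ (Submodule.sub_mem _
    (mul_mul_mem_Mser (ringComm_ringComm_mem_Lser_three _ _ _) _ _)
    (mul_mul_mem_Mser (ringComm_ringComm_mem_Lser_three _ _ _) _ _))
    (mul_mul_mem_Mser (ringComm_ringComm_mem_Lser_three _ _ _) _ _))

/-- In the free associative unital `ℂ`-algebra on two generators, `[x_1,x_2]^2` lies in
`M_3`, but not in `M_4 + span(L_3)`; in particular `[x_1,x_2]^2 ∉ M_4`. -/
theorem comm_sq_mem_M3_not_mem_M4_sup_L3 :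
    ringComm (FreeAlgebra.ι ℂ (0 : Fin 2)) (FreeAlgebra.ι ℂ (1 : Fin 2)) ^ 2 ∈
        Mser ℂ (FreeAlgebra ℂ (Fin 2)) 3 ∧
      ringComm (FreeAlgebra.ι ℂ (0 : Fin 2)) (FreeAlgebra.ι ℂ (1 : Fin 2)) ^ 2 ∉
        (Mser ℂ (FreeAlgebra ℂ (Fin 2)) 4 ⊔ Lser ℂ (FreeAlgebra ℂ (Fin 2)) 3) ∧
      ringComm (FreeAlgebra.ι ℂ (0 : Fin 2)) (FreeAlgebra.ι ℂ (1 : Fin 2)) ^ 2 ∉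
        Mser ℂ (FreeAlgebra ℂ (Fin 2)) 4 := by
  have h : ringComm (FreeAlgebra.ι ℂ (0 : Fin 2)) (FreeAlgebra.ι ℂ (1 : Fin 2)) ^ 2 ∉
      (Mser ℂ (FreeAlgebra ℂ (Fin 2)) 4 ⊔ Lser ℂ (FreeAlgebra ℂ (Fin 2)) 3) := by
    intro hmem
    have hle : Mser ℂ (FreeAlgebra ℂ (Fin 2)) 4 ⊔ Lser ℂ (FreeAlgebra ℂ (Fin 2)) 3 ≤
        LinearMap.ker gradedTrace :=
      sup_le Mser_four_le_ker_gradedTrace fun _ hl => gradedTrace_eq_zero_of_mem_lcs_succ 1 hl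
    have h0 := LinearMap.mem_ker.1 (hle hmem)
    rw [gradedTrace_ringComm_sq] at h0
    exact two_ne_zero h0
  exact ⟨ringComm_sq_mem_Mser_three two_ne_zero _ _, h, fun hm => h (Submodule.mem_sup_left hm)⟩
end
end

section
/- Let A_2 be the free associative unital ℂ-algebra on generators x_1, x_2. The element [x_1,[x_1,x_2]] does not lie in M_4(A_2); in particular, the image of L_3(A_2) in M_3(A_2)/M_4(A_2) is nonzero. -/
noncomputable section

/-- The `n × n` matrices whose entries vanish strictly below the `d`-th superdiagonal. -/
def upperBand (n d : ℕ) : Submodule ℂ (Matrix (Fin n) (Fin n) ℂ) where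
  carrier := {M | ∀ i j : Fin n, (j : ℕ) < i + d → M i j = 0}
  add_mem' hM hN i j h := by simp [hM i j h, hN i j h]
  zero_mem' _ _ _ := rfl
  smul_mem' c M hM i j h := by simp [hM i j h]

lemma mul_mem_upperBand {n d e : ℕ} {M N : Matrix (Fin n) (Fin n) ℂ}
    (hM : M ∈ upperBand n d) (hN : N ∈ upperBand n e) : M * N ∈ upperBand n (d + e) := by
  intro i j h
  rw [Matrix.mul_apply]
  refine Finset.sum_eq_zero fun l _ => ?_
  by_cases hl : (l : ℕ) < i + d
  · rw [hM i l hl, zero_mul]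
  · rw [hN l j (by omega), mul_zero]

lemma upperBand_antitone {n d e : ℕ} (h : d ≤ e) : upperBand n e ≤ upperBand n d :=
  fun _ hM i j hij => hM i j (by omega)

lemma eq_zero_of_mem_upperBand {n : ℕ} {M : Matrix (Fin n) (Fin n) ℂ}
    (hM : M ∈ upperBand n n) : M = 0 := by
  ext i j
  exact hM i j (by omega)

/-- If two matrices are scalar up to `upperBand`, their commutator lies in `upperBand`. -/
lemma commutator_mem_upperBand {n d : ℕ} {M N : Matrix (Fin n) (Fin n) ℂ} {c c' : ℂ}
    (hM : M - algebraMap ℂ _ c ∈ upperBand n 1) (hN : N - algebraMap ℂ _ c' ∈ upperBand n d) :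
    M * N - N * M ∈ upperBand n (d + 1) := by
  have h := sub_mem (add_comm 1 d ▸ mul_mem_upperBand hM hN) (mul_mem_upperBand hN hM)
  convert h using 1
  have h₁ := Algebra.commutes c N
  have h₂ := Algebra.commutes c' M
  have h₃ := Algebra.commutes c (algebraMap ℂ (Matrix (Fin n) (Fin n) ℂ) c')
  simp only [sub_mul, mul_sub, h₁, h₂, h₃]
  abel

lemma exists_lift_sub_mem_upperBand {n : ℕ} {X : Type*} {f : X → Matrix (Fin n) (Fin n) ℂ}
    (hf : ∀ x, f x ∈ upperBand n 1) (a : FreeAlgebra ℂ X) :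
    ∃ c, FreeAlgebra.lift ℂ f a - algebraMap ℂ _ c ∈ upperBand n 1 := by
  induction a using FreeAlgebra.induction with
  | grade0 r => exact ⟨r, by simp⟩
  | grade1 x => exact ⟨0, by simpa using hf x⟩
  | mul a b ha hb =>
    obtain ⟨c, hc⟩ := ha
    obtain ⟨d, hd⟩ := hb
    refine ⟨c * d, ?_⟩
    have h := add_mem (add_mem (upperBand_antitone (by omega) (mul_mem_upperBand hc hd))
      (Submodule.smul_mem _ c hd)) (Submodule.smul_mem _ d hc)
    convert h using 1
    simp only [map_mul, Algebra.algebraMap_eq_smul_one, sub_mul, mul_sub, smul_sub, smul_mul_assoc,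
      mul_smul_comm, one_mul, mul_one, smul_smul, mul_comm d c]
    abel
  | add a b ha hb =>
    obtain ⟨c, hc⟩ := ha
    obtain ⟨d, hd⟩ := hb
    refine ⟨c + d, ?_⟩
    convert add_mem hc hd using 1
    simp only [map_add]
    abel

lemma exists_lift_sub_mem_upperBand_of_mem_lcs {n : ℕ} {X : Type*}
    {f : X → Matrix (Fin n) (Fin n) ℂ} (hf : ∀ x, f x ∈ upperBand n 1) (m : ℕ) :
    ∀ a ∈ lcs ℂ (FreeAlgebra ℂ X) m,
      ∃ c, FreeAlgebra.lift ℂ f a - algebraMap ℂ _ c ∈ upperBand n (m + 1) ∧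
        (m ≠ 0 → c = 0) := by
  induction m with
  | zero =>
    intro a _
    obtain ⟨c, hc⟩ := exists_lift_sub_mem_upperBand hf a
    exact ⟨c, hc, fun h => (h rfl).elim⟩
  | succ m ih =>
    intro a ha
    refine ⟨0, ?_, fun _ => rfl⟩
    rw [map_zero, sub_zero]
    suffices h : lcs ℂ (FreeAlgebra ℂ X) (m + 1) ≤
        (upperBand n (m + 1 + 1)).comap (FreeAlgebra.lift ℂ f).toLinearMap from h ha
    refine Submodule.span_le.2 ?_
    rintro _ ⟨u, v, hv, rfl⟩
    obtain ⟨c, hc⟩ := exists_lift_sub_mem_upperBand hf u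
    obtain ⟨c', hc', -⟩ := ih v hv
    simpa using commutator_mem_upperBand hc hc'

lemma lift_eq_zero_of_mem_Mser {n : ℕ} (hn : 2 ≤ n) {X : Type*}
    {f : X → Matrix (Fin n) (Fin n) ℂ} (hf : ∀ x, f x ∈ upperBand n 1) {a : FreeAlgebra ℂ X}
    (ha : a ∈ Mser ℂ (FreeAlgebra ℂ X) n) : FreeAlgebra.lift ℂ f a = 0 := by
  suffices h : Mser ℂ (FreeAlgebra ℂ X) n ≤
      LinearMap.ker (FreeAlgebra.lift ℂ f).toLinearMap from h ha
  refine Submodule.span_le.2 ?_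
  rintro _ ⟨u, v, s, hs, rfl⟩
  obtain ⟨c, hc, h0⟩ := exists_lift_sub_mem_upperBand_of_mem_lcs hf (n - 1) s hs
  rw [h0 (by omega), map_zero, sub_zero, show n - 1 + 1 = n by omega] at hc
  simp [eq_zero_of_mem_upperBand hc]

/-- In the free associative unital `ℂ`-algebra on two generators, `[x_1,[x_1,x_2]]` lies
in `L_3` but not in `M_4`; in particular, the image of `L_3` in `M_3/M_4` is nonzero. -/
theorem comm_comm_not_mem_M4 :
    ringComm (FreeAlgebra.ι ℂ (0 : Fin 2))
        (ringComm (FreeAlgebra.ι ℂ (0 : Fin 2)) (FreeAlgebra.ι ℂ (1 : Fin 2))) ∈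
      Lser ℂ (FreeAlgebra ℂ (Fin 2)) 3 ∧
    ringComm (FreeAlgebra.ι ℂ (0 : Fin 2))
        (ringComm (FreeAlgebra.ι ℂ (0 : Fin 2)) (FreeAlgebra.ι ℂ (1 : Fin 2))) ∉
      Mser ℂ (FreeAlgebra ℂ (Fin 2)) 4 := by
  refine ⟨?_, fun h => ?_⟩
  · exact Submodule.subset_span
      ⟨_, _, Submodule.subset_span ⟨_, _, Submodule.mem_top, rfl⟩, rfl⟩
  · have hf : ∀ x, (![!![0, 1, 0, 0; 0, 0, 1, 0; 0, 0, 0, 0; 0, 0, 0, 0],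
        !![0, 0, 0, 0; 0, 0, 0, 0; 0, 0, 0, 1; 0, 0, 0, 0]] :
          Fin 2 → Matrix (Fin 4) (Fin 4) ℂ) x ∈ upperBand 4 1 := by
      intro x i j hij
      fin_cases x <;> fin_cases i <;> fin_cases j <;> simp_all
    have h03 := congrFun (congrFun (lift_eq_zero_of_mem_Mser (by norm_num) hf h) 0) 3
    simp [ringComm] at h03
end
end
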